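/- Let n ≥ 3 and k ≥ 0 be integers, and let G be obtained from K_n by subdividing every edge exactly k times. Then the connected tree-width of G equals (n − 1)(k + 1) − ⌊(k + 1)/2⌋. -/

import Mathlib

open SimpleGraph

universe u

/-- `x` and `y` are joined by a walk in `G` all of whose vertices lie in `S`. -/
def ConnIn {V : Type u} (G : SimpleGraph V) (S : Set V) (x y : V) : Prop :=
  ∃ p : G.Walk x y, ∀ v ∈ p.support, v ∈ S

/-- `S` is a (nonempty) connected vertex set of `G`, i.e. `G[S]` is connected. -/
def IsConnSet {V : Type u} (G : SimpleGraph V) (S : Set V) : Prop :=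
  S.Nonempty ∧ ∀ x ∈ S, ∀ y ∈ S, ConnIn G S x y

/-- A tree-decomposition of `G` over the tree `T`. -/
structure TreeDecomp {V ι : Type u} (G : SimpleGraph V) (T : SimpleGraph ι) where
  isTree : T.IsTree
  bag : ι → Set V
  exists_bag : ∀ v : V, ∃ t, v ∈ bag t
  exists_bag_adj : ∀ ⦃u v : V⦄, G.Adj u v → ∃ t, u ∈ bag t ∧ v ∈ bag t
  bag_sep : ∀ ⦃t₁ t₃ : ι⦄ (p : T.Walk t₁ t₃), p.IsPath → ∀ t₂ ∈ p.support,
      bag t₁ ∩ bag t₃ ⊆ bag t₂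

/-- The union of the bags `B u` over `u ∈ A`. -/
def unionBags {V ι : Type u} (B : ι → Set V) (A : Set ι) : Set V := ⋃ u ∈ A, B u

/-- `s` is a descendant of `t` in the tree `T` rooted at `r`:
`t` lies on the (unique) `r`–`s` path. -/
def Desc {ι : Type u} (T : SimpleGraph ι) (r t s : ι) : Prop :=
  ∃ p : T.Walk r s, p.IsPath ∧ t ∈ p.support

/-- The set of descendants of `t` (the subtree `T_t`). -/
def descSet {ι : Type u} (T : SimpleGraph ι) (r t : ι) : Set ι := {s | Desc T r t s}

/-- `s` is a child of `t` in the tree `T` rooted at `r`. -/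
def IsChild {ι : Type u} (T : SimpleGraph ι) (r t s : ι) : Prop :=
  T.Adj t s ∧ Desc T r t s

/-- The vertex set of the component of `t₁` in `T` minus the edge `t₁t₂`. -/
def Side {ι : Type u} (T : SimpleGraph ι) (t₁ t₂ : ι) : Set ι :=
  {u | ∃ p : T.Walk u t₁, p.IsPath ∧ t₂ ∉ p.support}

/-- The family of bags `B` is stable: for every tree edge `t₁t₂`, both sides
induce connected subgraphs of `G`. -/
def StableBags {V ι : Type u} (G : SimpleGraph V) (T : SimpleGraph ι) (B : ι → Set V) : Prop :=
  ∀ ⦃t₁ t₂ : ι⦄, T.Adj t₁ t₂ → IsConnSet G (unionBags B (Side T t₁ t₂))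

def TreeDecomp.Stable {V ι : Type u} {G : SimpleGraph V} {T : SimpleGraph ι}
    (td : TreeDecomp G T) : Prop :=
  StableBags G T td.bag

/-- `P` is a `t`-admissible path (w.r.t. the root `r` and bags `B`): a shortest
path lying in `V_{T_t}` joining two distinct components of `G[B t]`. -/
structure IsAdmissible {V ι : Type u} (G : SimpleGraph V) (T : SimpleGraph ι)
    (B : ι → Set V) (r t : ι) {x y : V} (P : G.Walk x y) : Prop where
  isPath : P.IsPath
  support_sub : ∀ v ∈ P.support, v ∈ unionBags B (descSet T r t)
  fst_mem : x ∈ B t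
  snd_mem : y ∈ B t
  not_conn : ¬ ConnIn G (B t) x y
  minimal : ∀ ⦃x' y' : V⦄ (Q : G.Walk x' y'), Q.IsPath →
      (∀ v ∈ Q.support, v ∈ unionBags B (descSet T r t)) →
      x' ∈ B t → y' ∈ B t → ¬ ConnIn G (B t) x' y' → P.length ≤ Q.length

/-- The updated bags obtained by adding the path `P` as in `(*)`:
`W_u = V_u ∪ (V(P) ∩ V_{T_u})` for descendants `u` of `t`, and `W_u = V_u` otherwise. -/
def updatedBag {V ι : Type u} (T : SimpleGraph ι) (B : ι → Set V) (r t : ι)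
    {G : SimpleGraph V} {x y : V} (P : G.Walk x y) (u : ι) : Set V :=
  B u ∪ {v | Desc T r t u ∧ v ∈ P.support ∧ v ∈ unionBags B (descSet T r u)}

/-- The tree-width of `G`: the least `k` such that `G` has a tree-decomposition
all of whose bags have at most `k + 1` vertices. -/
noncomputable def treewidth {V : Type u} (G : SimpleGraph V) : ℕ :=
  sInf {k | ∃ (ι : Type u) (T : SimpleGraph ι) (td : TreeDecomp G T),
    ∀ t, (td.bag t).ncard ≤ k + 1}

/-- A tree-decomposition is connected if every bag is a connected vertex set. -/
def TreeDecomp.IsConn {V ι : Type u} {G : SimpleGraph V} {T : SimpleGraph ι}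
    (td : TreeDecomp G T) : Prop :=
  ∀ t, IsConnSet G (td.bag t)

/-- The connected tree-width of `G`. -/
noncomputable def ctw {V : Type u} (G : SimpleGraph V) : ℕ :=
  sInf {k | ∃ (ι : Type u) (T : SimpleGraph ι) (td : TreeDecomp G T),
    td.IsConn ∧ ∀ t, (td.bag t).ncard ≤ k + 1}

/-- The weak connected tree-width of `G`: the least `k` such that `G` has a
tree-decomposition each of whose bags is contained in a connected set of at
most `k + 1` vertices. -/
noncomputable def wctw {V : Type u} (G : SimpleGraph V) : ℕ :=
  sInf {k | ∃ (ι : Type u) (T : SimpleGraph ι) (td : TreeDecomp G T),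
    ∀ t, ∃ X, td.bag t ⊆ X ∧ IsConnSet G X ∧ X.ncard ≤ k + 1}

/-- The characteristic vector over GF(2) of the edge set of a walk. -/
noncomputable def walkChar {V : Type u} {G : SimpleGraph V} {x y : V}
    (p : G.Walk x y) : Sym2 V → ZMod 2 :=
  fun e => by classical exact if e ∈ p.edges then 1 else 0

/-- The characteristic vectors of the cycles of `G` of length at most `ℓ`. -/
def cycleChars {V : Type u} (G : SimpleGraph V) (ℓ : ℕ) : Set (Sym2 V → ZMod 2) :=
  {f | ∃ (v : V) (p : G.Walk v v), p.IsCycle ∧ p.length ≤ ℓ ∧ f = walkChar p}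

/-- The cycles of length at most `ℓ` generate the cycle space of `G` over GF(2). -/
def GeneratesLE {V : Type u} (G : SimpleGraph V) (ℓ : ℕ) : Prop :=
  ∀ ⦃v : V⦄ (p : G.Walk v v), p.IsCycle →
    walkChar p ∈ Submodule.span (ZMod 2) (cycleChars G ℓ)

/-- `ℓ(G)`: the least `ℓ` such that the cycles of length at most `ℓ`
generate the cycle space of `G`. -/
noncomputable def ellGraph {V : Type u} (G : SimpleGraph V) : ℕ :=
  sInf {ℓ | GeneratesLE G ℓ}

/-- `Γ` is a set of cycles of `G` generating its cycle space over GF(2). -/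
def GeneratesSet {V : Type u} (G : SimpleGraph V) (Γ : Set (Σ v : V, G.Walk v v)) : Prop :=
  (∀ c ∈ Γ, c.2.IsCycle) ∧
  ∀ ⦃v : V⦄ (p : G.Walk v v), p.IsCycle →
    walkChar p ∈ Submodule.span (ZMod 2) {f | ∃ c ∈ Γ, f = walkChar c.2}

/-- A bramble: a collection of connected vertex sets, any two of which have
connected union. -/
def IsBramble {V : Type u} (G : SimpleGraph V) (B : Set (Set V)) : Prop :=
  (∀ S ∈ B, IsConnSet G S) ∧ ∀ S ∈ B, ∀ S' ∈ B, IsConnSet G (S ∪ S')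

/-- `X` is a connected cover of the bramble `B`. -/
def IsConnCover {V : Type u} (G : SimpleGraph V) (B : Set (Set V)) (X : Set V) : Prop :=
  IsConnSet G X ∧ ∀ S ∈ B, (X ∩ S).Nonempty

/-- The connected order of a bramble: the least size of a connected cover. -/
noncomputable def connOrder {V : Type u} (G : SimpleGraph V) (B : Set (Set V)) : ℕ :=
  sInf {n | ∃ X, IsConnCover G B X ∧ X.ncard = n}

/-- The maximum connected order of a bramble of `G`. -/
noncomputable def cbn {V : Type u} (G : SimpleGraph V) : ℕ :=
  sSup {n | ∃ B, IsBramble G B ∧ connOrder G B = n}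

/-- A geodesic cycle: a cycle containing a shortest `G`-path between any two
of its vertices. -/
def IsGeodesicCycle {V : Type u} (G : SimpleGraph V) {v : V} (p : G.Walk v v) : Prop :=
  p.IsCycle ∧ ∀ x ∈ p.support, ∀ y ∈ p.support,
    ∃ q : G.Walk x y, q.length = G.dist x y ∧ ∀ e ∈ q.edges, e ∈ p.edges

/-- The graph obtained from `K_n` by subdividing every edge exactly `k` times:
the edge between `i < j` is replaced by the path
`i, ((i,j),0), ((i,j),1), …, ((i,j),k-1), j`. -/
def subK (n k : ℕ) : SimpleGraph (Fin n ⊕ ({p : Fin n × Fin n // p.1 < p.2} × Fin k)) :=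
  SimpleGraph.fromRel fun u v =>
    match u, v with
    | Sum.inl i, Sum.inl j => i < j ∧ k = 0
    | Sum.inl i, Sum.inr (e, c) =>
        (e.val.1 = i ∧ (c : ℕ) = 0) ∨ (e.val.2 = i ∧ (c : ℕ) = k - 1)
    | Sum.inr (e, c), Sum.inr (e', c') => e = e' ∧ (c' : ℕ) = (c : ℕ) + 1
    | _, _ => False

section ConnIn

variable {V : Type u} {G : SimpleGraph V} {S : Set V} {x y z : V}

theorem ConnIn.refl (hx : x ∈ S) : ConnIn G S x x :=
  ⟨.nil, by simpa using hx⟩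

theorem ConnIn.symm (h : ConnIn G S x y) : ConnIn G S y x := by
  obtain ⟨p, hp⟩ := h
  exact ⟨p.reverse, by simpa using hp⟩

theorem ConnIn.trans (h : ConnIn G S x y) (h' : ConnIn G S y z) : ConnIn G S x z := by
  obtain ⟨p, hp⟩ := h
  obtain ⟨q, hq⟩ := h'
  refine ⟨p.append q, fun v hv => ?_⟩
  rcases (SimpleGraph.Walk.mem_support_append_iff _ _).1 hv with hv | hv
  exacts [hp v hv, hq v hv]

theorem ConnIn.of_adj (h : G.Adj x y) (hx : x ∈ S) (hy : y ∈ S) : ConnIn G S x y :=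
  ⟨h.toWalk, by simp [hx, hy]⟩

/-- A property that holds at `x` and spreads along edges inside `S` holds at every vertex
joined to `x` in `S`. -/
theorem ConnIn.induction {P : V → Prop} (h : ConnIn G S x y) (hx : P x)
    (step : ∀ u v, P u → v ∈ S → G.Adj u v → P v) : P y := by
  obtain ⟨p, hp⟩ := h
  induction p with
  | nil => exact hx
  | cons hadj p ih =>
    refine ih (step _ _ hx (hp _ ?_) hadj) fun v hv => hp v ?_
    · simp
    · simp [hv]

theorem isConnSet_of_center (hx : x ∈ S) (h : ∀ y ∈ S, ConnIn G S x y) : IsConnSet G S :=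
  ⟨⟨x, hx⟩, fun _ hy _ hz => (h _ hy).symm.trans (h _ hz)⟩

end ConnIn

section Tree

variable {ι : Type u} {T : SimpleGraph ι} {A : Set ι}

theorem SimpleGraph.IsAcyclic.support_subset_of_isPath (hT : T.IsAcyclic) {a b : ι}
    {p : T.Walk a b} (hp : p.IsPath) (q : T.Walk a b) : p.support ⊆ q.support := by
  classical
  have := (hT.subsingleton_path a b).elim ⟨p, hp⟩ ⟨q.bypass, q.bypass_isPath⟩
  simp only [Subtype.mk.injEq] at this
  rw [this]
  exact q.support_bypass_subset_support

theorem SimpleGraph.IsTree.length_eq_dist_of_isPath (hT : T.IsTree) {a b : ι}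
    {p : T.Walk a b} (hp : p.IsPath) : p.length = T.dist a b := by
  obtain ⟨q, hq, hlen⟩ := hT.connected.exists_path_of_dist a b
  have := (hT.isAcyclic.subsingleton_path a b).elim ⟨p, hp⟩ ⟨q, hq⟩
  simp only [Subtype.mk.injEq] at this
  rw [this, hlen]

/-- The vertex of a subtree `A` closest to the root `r` separates `r` from `A`. -/
theorem SimpleGraph.IsTree.mem_support_of_dist_le (hT : T.IsTree)
    (hA : ∀ a ∈ A, ∀ b ∈ A, ConnIn T A a b) {r t u : ι} (ht : t ∈ A)
    (hmin : ∀ a ∈ A, T.dist r t ≤ T.dist r a) (hu : u ∈ A)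
    {w : T.Walk r u} : t ∈ w.support := by
  classical
  obtain ⟨q, hq⟩ := hA t ht u hu
  obtain ⟨p, hp, hlen⟩ := hT.connected.exists_path_of_dist r t
  have hpath : (p.append q.bypass).IsPath := by
    rw [SimpleGraph.Walk.isPath_def, SimpleGraph.Walk.support_append, List.nodup_append']
    refine ⟨hp.support_nodup, q.bypass_isPath.support_nodup.tail, fun v hv hv' => ?_⟩
    have hvA : v ∈ A := hq v (q.support_bypass_subset_support (List.mem_of_mem_tail hv'))
    have hvt : v ≠ t := by
      rintro rfl
      have := q.bypass_isPath.support_nodup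
      rw [← SimpleGraph.Walk.cons_tail_support] at this
      exact (List.nodup_cons.1 this).1 hv'
    have h1 := SimpleGraph.Walk.length_takeUntil_lt_length hv hvt
    have h2 := SimpleGraph.dist_le (p.takeUntil v hv)
    have h3 := hmin v hvA
    omega
  exact hT.isAcyclic.support_subset_of_isPath hpath w
    ((SimpleGraph.Walk.mem_support_append_iff _ _).2 (.inl p.end_mem_support))

/-- If two subtrees meet, the one whose top vertex is lower has that vertex in common
with the other. -/
theorem SimpleGraph.IsTree.mem_of_dist_le (hT : T.IsTree) {A' : Set ι}
    (hA : ∀ a ∈ A, ∀ b ∈ A, ConnIn T A a b) (hA' : ∀ a ∈ A', ∀ b ∈ A', ConnIn T A' a b)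
    {r t t' u : ι} (ht : t ∈ A) (hmin : ∀ a ∈ A, T.dist r t ≤ T.dist r a)
    (ht' : t' ∈ A') (hmin' : ∀ a ∈ A', T.dist r t' ≤ T.dist r a)
    (hu : u ∈ A) (hu' : u ∈ A') (hle : T.dist r t' ≤ T.dist r t) : t ∈ A' := by
  obtain ⟨w, hw, -⟩ := hT.connected.exists_path_of_dist r u
  have h := hT.mem_support_of_dist_le hA ht hmin hu (w := w)
  have h' := hT.mem_support_of_dist_le hA' ht' hmin' hu' (w := w)
  obtain ⟨p, q, hp, hq, rfl⟩ := hw.mem_support_iff_exists_append.1 h'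
  rcases (SimpleGraph.Walk.mem_support_append_iff _ _).1 h with h | h
  · obtain ⟨a, b, -, -, rfl⟩ := hp.mem_support_iff_exists_append.1 h
    have h1 := hT.length_eq_dist_of_isPath hp
    have h2 := SimpleGraph.dist_le a
    rw [SimpleGraph.Walk.length_append] at h1
    rw [SimpleGraph.Walk.eq_of_length_eq_zero (p := b) (by omega)]
    exact ht'
  · obtain ⟨w', hw'⟩ := hA' t' ht' u hu'
    exact hw' t (hT.isAcyclic.support_subset_of_isPath hq w' h)

end Tree

section Bramble

variable {V ι : Type u} {G : SimpleGraph V} {T : SimpleGraph ι}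

theorem TreeDecomp.connIn_bags (td : TreeDecomp G T) {S : Set V} (hS : IsConnSet G S) :
    ∀ a ∈ {t | (td.bag t ∩ S).Nonempty}, ∀ b ∈ {t | (td.bag t ∩ S).Nonempty},
      ConnIn T {t | (td.bag t ∩ S).Nonempty} a b := by
  have key : ∀ v ∈ S, ∀ a b, v ∈ td.bag a → v ∈ td.bag b →
      ConnIn T {t | (td.bag t ∩ S).Nonempty} a b := by
    intro v hv a b ha hb
    obtain ⟨p, hp, -⟩ := td.isTree.connected.exists_path_of_dist a b
    exact ⟨p, fun t ht => ⟨v, td.bag_sep p hp t ht ⟨ha, hb⟩, hv⟩⟩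
  rintro a ⟨x, hxa, hx⟩ b ⟨y, hyb, hy⟩
  refine (ConnIn.induction (P := fun v => v ∈ S ∧ ∀ b, v ∈ td.bag b →
    ConnIn T {t | (td.bag t ∩ S).Nonempty} a b) (hS.2 x hx y hy)
    ⟨hx, fun b hb => key x hx a b hxa hb⟩ ?_).2 b hyb
  rintro u v ⟨hu, ih⟩ hv hadj
  obtain ⟨t, hut, hvt⟩ := td.exists_bag_adj hadj
  exact ⟨hv, fun b hb => (ih t hut).trans (key v hv t b hvt hb)⟩

/-- Some bag of a tree-decomposition covers a given family of pairwise touching connected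
sets. -/
theorem TreeDecomp.exists_bag_cover [Finite V] (td : TreeDecomp G T) {F : Set (Set V)}
    (hne : F.Nonempty) (hconn : ∀ S ∈ F, IsConnSet G S)
    (htouch : ∀ S ∈ F, ∀ S' ∈ F, ∃ u ∈ S, ∃ v ∈ S', u = v ∨ G.Adj u v) :
    ∃ t, ∀ S ∈ F, (td.bag t ∩ S).Nonempty := by
  obtain ⟨r⟩ := td.isTree.connected.nonempty
  have htop : ∀ S : F, ∃ t ∈ {t | (td.bag t ∩ S).Nonempty},
      ∀ a ∈ {t | (td.bag t ∩ S).Nonempty}, T.dist r t ≤ T.dist r a := by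
    rintro ⟨S, hS⟩
    obtain ⟨x, hx⟩ := (hconn S hS).1
    obtain ⟨t, ht⟩ := td.exists_bag x
    obtain ⟨t, ht, hmin⟩ := exists_minimal_of_wellFoundedLT
      (fun d => ∃ t ∈ {t | (td.bag t ∩ S).Nonempty}, T.dist r t = d) ⟨_, t, ⟨x, ht, hx⟩, rfl⟩
    obtain ⟨t', ht', rfl⟩ := ht
    refine ⟨t', ht', fun a ha => ?_⟩
    by_contra! hlt
    exact absurd (hmin ⟨a, ha, rfl⟩ hlt.le) (not_le.2 hlt)
  choose top htop hmin using htop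
  have : Nonempty F := hne.to_subtype
  obtain ⟨S, hS⟩ := Finite.exists_max fun S : F => T.dist r (top S)
  refine ⟨top S, fun S' hS' => ?_⟩
  obtain ⟨x, hx, y, hy, hxy⟩ := htouch S S.2 S' hS'
  obtain ⟨u, hu, hu'⟩ : ∃ u, x ∈ td.bag u ∧ y ∈ td.bag u := by
    rcases hxy with rfl | hxy
    · exact (td.exists_bag x).imp fun _ h => ⟨h, h⟩
    · exact td.exists_bag_adj hxy
  exact td.isTree.mem_of_dist_le (td.connIn_bags (hconn S S.2)) (td.connIn_bags (hconn S' hS'))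
    (htop S) (hmin S) (htop ⟨S', hS'⟩) (hmin ⟨S', hS'⟩) ⟨x, hu, hx⟩ ⟨y, hu', hy⟩ (hS ⟨S', hS'⟩)

end Bramble

section SubK

variable {n k : ℕ}

/-- The vertices of `subK n k`. -/
abbrev SubKVert (n k : ℕ) : Type := Fin n ⊕ ({p : Fin n × Fin n // p.1 < p.2} × Fin k)

/-- The vertex at distance `d` from `i` on the subdivided edge of `subK n k` from `i` to `j`. -/
def subKPt (k : ℕ) (i j : Fin n) (d : ℕ) : SubKVert n k :=
  if h0 : d = 0 then .inl i
  else if hk : k < d then .inl j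
  else if h : i < j then .inr (⟨(i, j), h⟩, ⟨d - 1, by omega⟩)
  else if h : j < i then .inr (⟨(j, i), h⟩, ⟨k - d, by omega⟩)
  else .inl i

@[simp] theorem subKPt_zero (i j : Fin n) : subKPt k i j 0 = .inl i := by simp [subKPt]

@[simp] theorem subKPt_top (i j : Fin n) : subKPt k i j (k + 1) = .inl j := by simp [subKPt]

theorem subKPt_of_lt {i j : Fin n} (h : i < j) {d : ℕ} (hd : d < k) :
    subKPt k i j (d + 1) = .inr (⟨(i, j), h⟩, ⟨d, hd⟩) := by
  simp [subKPt, h, show ¬ k < d + 1 by omega]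

theorem subKPt_inr (e : {p : Fin n × Fin n // p.1 < p.2}) (c : Fin k) :
    subKPt k e.1.1 e.1.2 (c + 1) = .inr (e, c) := by
  rw [subKPt_of_lt e.2 c.2]

theorem subKPt_symm {i j : Fin n} (h : i ≠ j) {d : ℕ} (hd : d ≤ k + 1) :
    subKPt k j i (k + 1 - d) = subKPt k i j d := by
  unfold subKPt
  have h1 : i < j ∧ ¬ j < i ∨ ¬ i < j ∧ j < i := by grind
  rcases h1 with h1 | h1 <;> simp only [h1, dite_true, dite_false] <;> split_ifs <;>
    first | rfl | (exfalso; omega) | (simp; omega)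

theorem subKPt_inj {i j i' j' : Fin n} (h : i ≠ j) {d d' : ℕ} (h0 : 0 < d)
    (hd : d ≤ k) (heq : subKPt k i j d = subKPt k i' j' d') :
    (i' = i ∧ j' = j ∧ d' = d) ∨ (i' = j ∧ j' = i ∧ d' = k + 1 - d) := by
  unfold subKPt at heq
  split_ifs at heq <;> simp at heq <;> grind

theorem subKPt_ne_inl {i j l : Fin n} (h : i ≠ j) {d : ℕ} (h0 : 0 < d) (hd : d ≤ k) :
    subKPt k i j d ≠ .inl l := by
  unfold subKPt
  split_ifs <;> first | omega | simp

theorem subKPt_cases (hn : 2 ≤ n) (x : SubKVert n k) :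
    ∃ i j d, i ≠ j ∧ d ≤ k ∧ x = subKPt k i j d := by
  rcases x with i | ⟨e, c⟩
  · have : Nontrivial (Fin n) := Fin.nontrivial_iff_two_le.2 hn
    obtain ⟨j, hj⟩ := exists_ne i
    exact ⟨i, j, 0, hj.symm, by omega, by simp⟩
  · exact ⟨_, _, _, e.2.ne, c.2, (subKPt_inr e c).symm⟩

theorem subK_adj_subKPt {i j : Fin n} (h : i ≠ j) {d : ℕ} (hd : d ≤ k) :
    (subK n k).Adj (subKPt k i j d) (subKPt k i j (d + 1)) := by
  wlog hij : i < j generalizing i j d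
  · have := (this h.symm (d := k - d) (by omega) (by grind)).symm
    rw [← subKPt_symm h (by omega), ← subKPt_symm h (by omega)]
    convert this using 2 <;> omega
  rcases d with _ | d
  · rcases Nat.eq_zero_or_pos k with rfl | hk
    · simp [subK, subKPt, hij, h]
    · simp only [subKPt_zero, subKPt_of_lt hij hk]
      simp [subK]
  · rcases hd.eq_or_lt with rfl | hk
    · rw [subKPt_top, subKPt_of_lt hij (by omega)]
      simp [subK]
    · rw [subKPt_of_lt hij (by omega), subKPt_of_lt hij hk]
      simp [subK]

theorem exists_subKPt_of_adj {x y : SubKVert n k} (h : (subK n k).Adj x y) :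
    ∃ i j d, i ≠ j ∧ d ≤ k ∧ x = subKPt k i j d ∧ y = subKPt k i j (d + 1) := by
  have hrev : ∀ {x y : SubKVert n k},
      (∃ i j d, i ≠ j ∧ d ≤ k ∧ x = subKPt k i j d ∧ y = subKPt k i j (d + 1)) →
      ∃ i j d, i ≠ j ∧ d ≤ k ∧ y = subKPt k i j d ∧ x = subKPt k i j (d + 1) := by
    rintro x y ⟨i, j, d, hij, hd, rfl, rfl⟩
    refine ⟨j, i, k - d, hij.symm, by omega, ?_, ?_⟩
    · rw [← subKPt_symm hij (by omega)]
      congr 1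
      omega
    · rw [← subKPt_symm hij (by omega)]
      congr 1
      omega
  have key : ∀ x y : SubKVert n k, (match x, y with
    | Sum.inl i, Sum.inl j => i < j ∧ k = 0
    | Sum.inl i, Sum.inr (e, c) =>
        (e.val.1 = i ∧ (c : ℕ) = 0) ∨ (e.val.2 = i ∧ (c : ℕ) = k - 1)
    | Sum.inr (e, c), Sum.inr (e', c') => e = e' ∧ (c' : ℕ) = (c : ℕ) + 1
    | _, _ => False) →
      ∃ i j d, i ≠ j ∧ d ≤ k ∧ x = subKPt k i j d ∧ y = subKPt k i j (d + 1) := by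
    intro x y h'
    rcases x with i | ⟨e, c⟩ <;> rcases y with j | ⟨e', c'⟩ <;> simp only at h'
    · obtain ⟨hij, rfl⟩ := h'
      exact ⟨i, j, 0, hij.ne, le_rfl, by simp, by simp [subKPt]⟩
    · have := c'.2
      rcases h' with ⟨rfl, hc⟩ | ⟨rfl, hc⟩
      · exact ⟨_, _, 0, e'.2.ne, by omega, by simp, by rw [← subKPt_inr, hc]⟩
      · refine hrev ⟨_, _, k, e'.2.ne, le_rfl, ?_, by simp⟩
        rw [← subKPt_inr]
        congr 1
        omega
    · obtain ⟨rfl, hc⟩ := h'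
      exact ⟨_, _, c + 1, e.2.ne, c.2, (subKPt_inr e c).symm, by rw [← subKPt_inr, hc]⟩
  rw [subK, SimpleGraph.fromRel_adj] at h
  exact h.2.elim (key x y) fun h => hrev (key y x h)

theorem connIn_subKPt {S : Set (SubKVert n k)} {i j : Fin n} (h : i ≠ j) {d : ℕ}
    (hd : d ≤ k + 1) (hS : ∀ d' ≤ d, subKPt k i j d' ∈ S) :
    ConnIn (subK n k) S (.inl i) (subKPt k i j d) := by
  induction d with
  | zero => simpa using ConnIn.refl (by simpa using hS 0 le_rfl)
  | succ d ih =>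
    exact (ih (by omega) fun d' hd' => hS d' (by omega)).trans
      (.of_adj (subK_adj_subKPt h (by omega)) (hS _ (by omega)) (hS _ le_rfl))

section Segments

variable {X Y : Set (SubKVert n k)}

/-- Every vertex of a connected set `X` is reached from a branch vertex along an initial segment
of a subdivided edge that lies in `X`; the branch vertex can be taken in any set `R` that is
closed under the subdivided edges contained in `X`. -/
theorem IsConnSet.exists_segment (hn : 2 ≤ n) (hX : IsConnSet (subK n k) X) {r : Fin n}
    (hr : .inl r ∈ X) {R : Fin n → Prop} (hR : R r)
    (hstep : ∀ i j, i ≠ j → R i → (∀ d ≤ k + 1, subKPt k i j d ∈ X) → R j) {x : SubKVert n k}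
    (hx : x ∈ X) :
    ∃ i j d, i ≠ j ∧ d ≤ k ∧ R i ∧ x = subKPt k i j d ∧ ∀ d' ≤ d, subKPt k i j d' ∈ X := by
  refine (hX.2 _ hr _ hx).induction (P := fun x => ∃ i j d, i ≠ j ∧ d ≤ k ∧ R i ∧
    x = subKPt k i j d ∧ ∀ d' ≤ d, subKPt k i j d' ∈ X) ?_ ?_
  · have : Nontrivial (Fin n) := Fin.nontrivial_iff_two_le.2 hn
    obtain ⟨j, hj⟩ := exists_ne r
    exact ⟨r, j, 0, hj.symm, by omega, hR, by simp, by simpa using hr⟩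
  · rintro _ v ⟨a, b, d, hab, hd, ha, rfl, hseg⟩ hv hadj
    have extend : ∀ a b d, a ≠ b → d ≤ k → R a → (∀ d' ≤ d, subKPt k a b d' ∈ X) →
        subKPt k a b (d + 1) ∈ X → ∃ i j e, i ≠ j ∧ e ≤ k ∧ R i ∧
          subKPt k a b (d + 1) = subKPt k i j e ∧ ∀ d' ≤ e, subKPt k i j d' ∈ X := by
      intro a b d hab hd ha hseg hmem
      have hseg' : ∀ d' ≤ d + 1, subKPt k a b d' ∈ X := fun d' hd' => by
        rcases hd'.eq_or_lt with rfl | hlt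
        exacts [hmem, hseg _ (by omega)]
      rcases hd.eq_or_lt with rfl | hlt
      · exact ⟨b, a, 0, hab.symm, by omega, hstep a b hab ha hseg', by simp,
          by simpa using hseg' _ le_rfl⟩
      · exact ⟨a, b, d + 1, hab, hlt, ha, rfl, hseg'⟩
    obtain ⟨i, j, c, hij, hc, heq, rfl⟩ := exists_subKPt_of_adj hadj
    rcases Nat.eq_zero_or_pos d with rfl | hd0
    · rcases Nat.eq_zero_or_pos c with rfl | hc0
      · obtain rfl : a = i := by simpa using heq
        exact extend a j 0 hij hc ha (by simpa using hseg 0 le_rfl) hv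
      · exact absurd heq.symm (by simpa using subKPt_ne_inl hij hc0 hc)
    · rcases subKPt_inj hab hd0 hd heq with ⟨rfl, rfl, rfl⟩ | ⟨rfl, rfl, rfl⟩
      · exact extend i j c hij hd ha hseg hv
      · have : subKPt k i j (k + 1 - d + 1) = subKPt k j i (d - 1) := by
          rw [← subKPt_symm hab (by omega)]
          congr 1
          omega
        rw [this]
        exact ⟨j, i, d - 1, hab, by omega, ha, rfl, fun d' hd' => hseg d' (by omega)⟩

theorem IsConnSet.subKPt_mem_of_ge (hn : 2 ≤ n) (hX : IsConnSet (subK n k) X) {r : Fin n}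
    (hr : .inl r ∈ X) {i j : Fin n} (hij : i ≠ j) (hi : .inl i ∉ X) {d d' : ℕ}
    (hd : subKPt k i j d ∈ X) (hdd' : d ≤ d') (hd' : d' ≤ k + 1) : subKPt k i j d' ∈ X := by
  rcases Nat.eq_zero_or_pos d with rfl | hd0
  · exact absurd hd (by simpa using hi)
  rcases (hdd'.trans hd').eq_or_lt with rfl | hlt
  · rwa [le_antisymm hd' hdd']
  obtain ⟨a, b, e, hab, he, -, heq, hseg⟩ :=
    hX.exists_segment hn hr (R := fun _ => True) trivial (fun _ _ _ _ _ => trivial) hd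
  rcases subKPt_inj hij hd0 (by omega) heq with ⟨rfl, rfl, rfl⟩ | ⟨rfl, rfl, rfl⟩
  · exact absurd (hseg 0 (by omega)) (by simpa using hi)
  · rw [← subKPt_symm hij hd']
    exact hseg _ (by omega)

theorem IsConnSet.subKPt_mem_of_le (hn : 2 ≤ n) (hX : IsConnSet (subK n k) X) {r : Fin n}
    (hr : .inl r ∈ X) {i j : Fin n} (hij : i ≠ j) (hj : .inl j ∉ X) {d d' : ℕ}
    (hd : subKPt k i j d ∈ X) (hdd' : d' ≤ d) (hdk : d ≤ k + 1) : subKPt k i j d' ∈ X := by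
  rw [← subKPt_symm hij (by omega)] at hd ⊢
  exact hX.subKPt_mem_of_ge hn hr hij.symm hj hd (by omega) (by omega)

/-- A connected set without branch vertices lies on a single subdivided edge. -/
theorem IsConnSet.subset_subKPt (hn : 2 ≤ n) (hX : IsConnSet (subK n k) X)
    (hr : ∀ r, .inl r ∉ X) :
    ∃ i j, i ≠ j ∧ X ⊆ {x | ∃ d ≤ k + 1, x = subKPt k i j d} := by
  obtain ⟨x, hx⟩ := hX.1
  obtain ⟨i, j, d, hij, hd, rfl⟩ := subKPt_cases hn x
  refine ⟨i, j, hij, fun y hy => ?_⟩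
  refine ((hX.2 _ hx _ hy).induction (P := fun y => y ∈ X ∧ ∃ d ≤ k + 1, y = subKPt k i j d)
    ⟨hx, d, by omega, rfl⟩ ?_).2
  rintro _ v ⟨hu, c, hc, rfl⟩ hv hadj
  refine ⟨hv, ?_⟩
  have hc0 : 0 < c := Nat.pos_of_ne_zero fun h => hr i (by simpa [h] using hu)
  have hck : c ≤ k := by
    by_contra h
    obtain rfl : c = k + 1 := by omega
    exact hr j (by simpa using hu)
  obtain ⟨a, b, e, hab, he, heq, rfl⟩ := exists_subKPt_of_adj hadj
  rcases subKPt_inj hij hc0 hck heq with ⟨rfl, rfl, rfl⟩ | ⟨rfl, rfl, rfl⟩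
  · exact ⟨e + 1, by omega, rfl⟩
  · exact ⟨c - 1, by omega, by rw [← subKPt_symm hij (by omega)]; congr 1; omega⟩

theorem isConnSet_subKPt {i j : Fin n} (hij : i ≠ j) :
    IsConnSet (subK n k) {x | ∃ d ≤ k + 1, x = subKPt k i j d} := by
  refine isConnSet_of_center (x := .inl i) ⟨0, by omega, by simp⟩ ?_
  rintro _ ⟨d, hd, rfl⟩
  exact connIn_subKPt hij hd fun d' hd' => ⟨d', by omega, rfl⟩

theorem ncard_subKPt_le (i j : Fin n) :
    {x | ∃ d ≤ k + 1, x = subKPt k i j d}.ncard ≤ k + 2 := by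
  have : {x | ∃ d ≤ k + 1, x = subKPt k i j d} =
      ((Finset.range (k + 2)).image (subKPt k i j) : Finset _) := by
    ext x
    simp [Nat.lt_succ_iff, eq_comm]
  rw [this, Set.ncard_coe_finset]
  simpa using Finset.card_image_le (s := Finset.range (k + 2)) (f := subKPt k i j)

/-- The part of `subK n k` outside `X` that is visible from the branch vertices missing
from `X` along subdivided edges. -/
def subKFar (X : Set (SubKVert n k)) : Set (SubKVert n k) :=
  {x | ∃ i j d, i ≠ j ∧ d ≤ k ∧ x = subKPt k i j d ∧ ∀ d' ≤ d, subKPt k i j d' ∉ X}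

theorem notMem_of_mem_subKFar {x : SubKVert n k} (hx : x ∈ subKFar X) : x ∉ X := by
  obtain ⟨i, j, d, -, -, rfl, h⟩ := hx
  exact h d le_rfl

theorem inl_mem_subKFar (hn : 2 ≤ n) {i : Fin n} (hi : .inl i ∉ X) : .inl i ∈ subKFar X := by
  have : Nontrivial (Fin n) := Fin.nontrivial_iff_two_le.2 hn
  obtain ⟨j, hj⟩ := exists_ne i
  exact ⟨i, j, 0, hj.symm, by omega, by simp, by simpa using hi⟩

theorem IsConnSet.isConnSet_subKFar (hn : 2 ≤ n) (hX : IsConnSet (subK n k) X) {r v : Fin n}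
    (hr : .inl r ∈ X) (hv : .inl v ∉ X) : IsConnSet (subK n k) (subKFar X) := by
  refine isConnSet_of_center (inl_mem_subKFar hn hv) ?_
  rintro _ ⟨i, j, d, hij, hd, rfl, h⟩
  have hray : ConnIn (subK n k) (subKFar X) (.inl i) (subKPt k i j d) :=
    connIn_subKPt hij (by omega) fun d' hd' =>
      ⟨i, j, d', hij, by omega, rfl, fun d'' hd'' => h d'' (by omega)⟩
  refine ConnIn.trans ?_ hray
  have hi : .inl i ∉ X := by simpa using h 0 (by omega)
  rcases eq_or_ne v i with rfl | hvi
  · exact .refl (inl_mem_subKFar hn hv)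
  have := connIn_subKPt (k := k) (S := subKFar X) hvi le_rfl fun d' hd' => ?_
  · simpa using this
  rcases hd'.eq_or_lt with rfl | hlt
  · simpa using inl_mem_subKFar hn hi
  · refine ⟨v, i, d', hvi, by omega, rfl, fun d'' hd'' hmem => hi ?_⟩
    simpa using hX.subKPt_mem_of_ge hn hr hvi hv hmem (by omega) le_rfl

/-- If the far sides of `X` and `Y` do not touch, then `X` and `Y` overlap on each subdivided
edge between branch vertices missing from `X` and from `Y`. -/
theorem exists_overlap_of_not_touch (hn : 2 ≤ n) (hX : IsConnSet (subK n k) X)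
    (hY : IsConnSet (subK n k) Y) {v w : Fin n} (hvw : v ≠ w)
    (hvX : .inl v ∉ X) (hwX : .inl w ∈ X) (hwY : .inl w ∉ Y) (hvY : .inl v ∈ Y)
    (h : ∀ x ∈ subKFar X, ∀ y ∈ subKFar Y, ¬ (subK n k).Adj x y) :
    ∃ a, 0 < a ∧ a ≤ k ∧ (∀ d, a ≤ d → d ≤ k + 1 → subKPt k v w d ∈ X) ∧
      ∀ d ≤ a, subKPt k v w d ∈ Y := by
  classical
  obtain ⟨a, hak, haX, hmin⟩ : ∃ a ≤ k + 1, subKPt k v w a ∈ X ∧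
      ∀ d < a, subKPt k v w d ∉ X := by
    have hex : ∃ d, d ≤ k + 1 ∧ subKPt k v w d ∈ X := ⟨k + 1, le_rfl, by simpa using hwX⟩
    have hle := (Nat.find_spec hex).1
    exact ⟨Nat.find hex, hle, (Nat.find_spec hex).2, fun d hd hd' =>
      Nat.find_min hex hd ⟨by omega, hd'⟩⟩
  have ha0 : 0 < a := Nat.pos_of_ne_zero fun h => hvX (by simpa [h] using haX)
  have haY : subKPt k v w a ∈ Y := by
    by_contra haY
    have hmX : subKPt k v w (a - 1) ∈ subKFar X :=
      ⟨v, w, a - 1, hvw, by omega, rfl, fun d hd => hmin d (by omega)⟩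
    have hmY : subKPt k v w a ∈ subKFar Y := by
      refine ⟨w, v, k + 1 - a, hvw.symm, by omega, (subKPt_symm hvw hak).symm, fun d hd hdY => ?_⟩
      rw [← subKPt_symm hvw hak] at haY
      exact haY (hY.subKPt_mem_of_ge hn hvY hvw.symm hwY hdY hd (by omega))
    obtain ⟨b, rfl⟩ : ∃ b, a = b + 1 := ⟨a - 1, by omega⟩
    exact h _ hmX _ hmY (subK_adj_subKPt hvw (by omega))
  refine ⟨a, ha0, ?_, fun d hd hdk => hX.subKPt_mem_of_ge hn hwX hvw hvX haX hd hdk,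
    fun d hd => hY.subKPt_mem_of_le hn hvY hvw hwY haY hd hak⟩
  by_contra hlt
  obtain rfl : a = k + 1 := by omega
  exact hwY (by simpa using haY)

end Segments

section Counting

open Classical in
theorem ncard_subKVert (X : Set (SubKVert n k)) :
    X.ncard = (Finset.univ.filter fun i : Fin n => .inl i ∈ X).card +
      ∑ e : {p : Fin n × Fin n // p.1 < p.2},
        (Finset.univ.filter fun c : Fin k => .inr (e, c) ∈ X).card := by
  rw [Set.ncard_eq_toFinset_card', ← Set.filter_mem_univ_eq_toFinset]
  simp only [Finset.card_filter, Fintype.sum_sum_type, Fintype.sum_prod_type]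

variable {X Y : Set (SubKVert n k)}

open Classical in
/-- A connected set with `b` branch vertices contains at least `b - 1` subdivided edges. -/
theorem IsConnSet.card_branch_le (hn : 2 ≤ n) (hX : IsConnSet (subK n k) X) {r : Fin n}
    (hr : .inl r ∈ X) :
    (Finset.univ.filter fun i : Fin n => .inl i ∈ X).card ≤
      (Finset.univ.filter fun e : {p : Fin n × Fin n // p.1 < p.2} =>
        ∀ d ≤ k + 1, subKPt k e.1.1 e.1.2 d ∈ X).card + 1 := by
  set F := {e : {p : Fin n × Fin n // p.1 < p.2} // ∀ d ≤ k + 1, subKPt k e.1.1 e.1.2 d ∈ X}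
  set B := {i : Fin n // .inl i ∈ X}
  let f : F → Sym2 B := fun e => s(⟨e.1.1.1, by simpa using e.2 0 (by omega)⟩,
    ⟨e.1.1.2, by simpa using e.2 (k + 1) le_rfl⟩)
  let H : SimpleGraph B := SimpleGraph.fromEdgeSet (Set.range f)
  have hadj : ∀ i j, i ≠ j → ∀ hi : .inl i ∈ X, (∀ d ≤ k + 1, subKPt k i j d ∈ X) →
      ∃ hj : .inl j ∈ X, H.Adj ⟨i, hi⟩ ⟨j, hj⟩ := by
    intro i j hij hi h
    refine ⟨by simpa using h (k + 1) le_rfl, ?_⟩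
    rw [SimpleGraph.fromEdgeSet_adj]
    refine ⟨?_, fun h => hij (congrArg Subtype.val h)⟩
    rcases hij.lt_or_gt with hlt | hlt
    · exact ⟨⟨⟨(i, j), hlt⟩, h⟩, rfl⟩
    · refine ⟨⟨⟨(j, i), hlt⟩, fun d hd => ?_⟩, Sym2.eq_swap⟩
      rw [← subKPt_symm hij.symm hd]
      exact h _ (by omega)
  have hreach : ∀ b : B, H.Reachable ⟨r, hr⟩ b := by
    rintro ⟨b, hb⟩
    obtain ⟨i, j, d, hij, hd, ⟨hi, hri⟩, heq, -⟩ := hX.exists_segment hn hr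
      (R := fun i => ∃ hi, H.Reachable ⟨r, hr⟩ ⟨i, hi⟩) ⟨hr, .rfl⟩
      (fun i j hij ⟨hi, hri⟩ h => (hadj i j hij hi h).imp fun _ h => hri.trans h.reachable) hb
    rcases Nat.eq_zero_or_pos d with rfl | hd0
    · obtain rfl : b = i := by simpa using heq
      exact hri
    · exact absurd heq.symm (subKPt_ne_inl hij hd0 hd)
  have : Nonempty B := ⟨⟨r, hr⟩⟩
  have hconn : H.Connected := ⟨fun a b => (hreach a).symm.trans (hreach b)⟩
  have h1 := hconn.card_vert_le_card_edgeSet_add_one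
  have h2 : Nat.card H.edgeSet ≤ Nat.card F := by
    rw [SimpleGraph.edgeSet_fromEdgeSet]
    exact (Nat.card_mono (Set.finite_range f) Set.sdiff_subset).trans (Finite.card_range_le f)
  rw [Nat.card_eq_fintype_card, Fintype.card_subtype] at h1
  rw [Nat.card_eq_fintype_card (α := F), Fintype.card_subtype] at h2
  omega

open Classical in
theorem IsConnSet.le_ncard (hn : 2 ≤ n) (hX : IsConnSet (subK n k) X) {r : Fin n}
    (hr : .inl r ∈ X) (C : Finset {p : Fin n × Fin n // p.1 < p.2})
    (hC : ∀ e ∈ C, .inl e.1.1 ∉ X ∨ .inl e.1.2 ∉ X) :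
    (Finset.univ.filter fun i : Fin n => .inl i ∈ X).card +
      k * ((Finset.univ.filter fun i : Fin n => .inl i ∈ X).card - 1) +
      ∑ e ∈ C, (Finset.univ.filter fun c : Fin k => .inr (e, c) ∈ X).card ≤ X.ncard := by
  have hF := hX.card_branch_le hn hr
  set F := Finset.univ.filter fun e : {p : Fin n × Fin n // p.1 < p.2} =>
    ∀ d ≤ k + 1, subKPt k e.1.1 e.1.2 d ∈ X with hF_def
  have hdisj : Disjoint F C := by
    rw [Finset.disjoint_left]
    intro e he heC
    simp only [hF_def, Finset.mem_filter, Finset.mem_univ, true_and] at he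
    rcases hC e heC with h | h
    · exact h (by simpa using he 0 (by omega))
    · exact h (by simpa using he (k + 1) le_rfl)
  have hfull : ∀ e ∈ F, k ≤ (Finset.univ.filter fun c : Fin k => .inr (e, c) ∈ X).card := by
    intro e he
    simp only [hF_def, Finset.mem_filter, Finset.mem_univ, true_and] at he
    rw [Finset.filter_true_of_mem, Finset.card_univ, Fintype.card_fin]
    intro c _
    rw [← subKPt_inr]
    exact he _ (by omega)
  have h1 := Finset.card_nsmul_le_sum F _ k hfull
  have h2 := Finset.sum_le_sum_of_subset (Finset.subset_univ (F ∪ C))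
    (f := fun e => (Finset.univ.filter fun c : Fin k => .inr (e, c) ∈ X).card)
  rw [Finset.sum_union hdisj] at h2
  rw [ncard_subKVert X]
  have h3 := Nat.mul_le_mul_left k (Nat.sub_le_of_le_add hF)
  rw [smul_eq_mul, mul_comm] at h1
  omega

open Classical in
theorem le_card_add_card_of_overlap (e : {p : Fin n × Fin n // p.1 < p.2}) {a : ℕ} (ha0 : 0 < a)
    (hak : a ≤ k) (hX : ∀ d, a ≤ d → d ≤ k + 1 → subKPt k e.1.1 e.1.2 d ∈ X)
    (hY : ∀ d ≤ a, subKPt k e.1.1 e.1.2 d ∈ Y) :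
    k + 1 ≤ (Finset.univ.filter fun c : Fin k => .inr (e, c) ∈ X).card +
      (Finset.univ.filter fun c : Fin k => .inr (e, c) ∈ Y).card := by
  rw [← Finset.card_union_add_card_inter]
  refine Nat.add_le_add ?_ (Finset.card_pos.2 ⟨⟨a - 1, by omega⟩, ?_⟩)
  · rw [Finset.eq_univ_of_forall (s := _ ∪ _), Finset.card_univ, Fintype.card_fin]
    intro c
    simp only [Finset.mem_union, Finset.mem_filter, Finset.mem_univ, true_and, ← subKPt_inr]
    rcases le_total a (c + 1) with h | h
    exacts [.inl (hX _ h (by omega)), .inr (hY _ h)]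
  · simp only [Finset.mem_inter, Finset.mem_filter, Finset.mem_univ, true_and, ← subKPt_inr]
    exact ⟨hX _ (by omega) (by omega), hY _ (by omega)⟩

/-- A connected set with a branch vertex and at most `(n - 1)(k + 1) - ⌊(k + 1)/2⌋` vertices
misses some branch vertex. -/
theorem IsConnSet.exists_inl_notMem (hn : 2 ≤ n) (hX : IsConnSet (subK n k) X) {r : Fin n}
    (hr : .inl r ∈ X) (hle : X.ncard ≤ (n - 1) * (k + 1) - (k + 1) / 2) :
    ∃ v, .inl v ∉ X := by
  classical
  by_contra! h
  have := hX.le_ncard hn hr ∅ (by simp)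
  rw [Finset.filter_true_of_mem fun i _ => h i, Finset.card_univ, Fintype.card_fin] at this
  obtain ⟨n, rfl⟩ : ∃ m, n = m + 1 := ⟨n - 1, by omega⟩
  simp only [Finset.sum_empty, Nat.add_sub_cancel] at this hle
  have h2 : n * (k + 1) = k * n + n := by ring
  omega

/-- The far sides of two small connected sets touch. -/
theorem exists_touch_subKFar (hn : 2 ≤ n) (hX : IsConnSet (subK n k) X)
    (hY : IsConnSet (subK n k) Y) {r r' : Fin n} (hr : .inl r ∈ X) (hr' : .inl r' ∈ Y)
    (hXle : X.ncard ≤ (n - 1) * (k + 1) - (k + 1) / 2)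
    (hYle : Y.ncard ≤ (n - 1) * (k + 1) - (k + 1) / 2) :
    ∃ x ∈ subKFar X, ∃ y ∈ subKFar Y, x = y ∨ (subK n k).Adj x y := by
  classical
  by_contra! hno
  have hXY : ∀ v, .inl v ∉ X → .inl v ∈ Y := fun v hv => by
    by_contra hv'
    exact (hno _ (inl_mem_subKFar hn hv) _ (inl_mem_subKFar hn hv')).1 rfl
  have hYX : ∀ v, .inl v ∉ Y → .inl v ∈ X := fun v hv => by
    by_contra hv'
    exact hv (hXY v hv')
  set C := Finset.univ.filter fun e : {p : Fin n × Fin n // p.1 < p.2} =>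
    (.inl e.1.1 ∉ X ∧ .inl e.1.2 ∉ Y) ∨ (.inl e.1.1 ∉ Y ∧ .inl e.1.2 ∉ X) with hC_def
  have hC : ∀ e ∈ C, (.inl e.1.1 ∉ X ∧ .inl e.1.2 ∉ Y) ∨ (.inl e.1.1 ∉ Y ∧ .inl e.1.2 ∉ X) :=
    fun e he => by simpa [hC_def] using he
  have h1 := hX.le_ncard hn hr C fun e he => (hC e he).imp And.left And.right
  have h2 := hY.le_ncard hn hr' C fun e he => ((hC e he).imp And.right And.left).symm
  have h3 : (Finset.univ.filter fun v : Fin n => .inl v ∉ X).card *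
      (Finset.univ.filter fun v : Fin n => .inl v ∉ Y).card ≤ C.card := by
    rw [← Finset.card_product]
    refine Finset.card_le_card_of_surjOn
      (fun e => if .inl e.1.1 ∉ X then (e.1.1, e.1.2) else (e.1.2, e.1.1)) ?_
    rintro ⟨v, w⟩ hvw
    simp only [Finset.coe_product, Set.mem_prod, Finset.mem_coe, Finset.mem_filter,
      Finset.mem_univ, true_and] at hvw
    obtain ⟨hv, hw⟩ := hvw
    have hne : v ≠ w := by
      rintro rfl
      exact hw (hXY v hv)
    rcases hne.lt_or_gt with hlt | hlt
    · exact ⟨⟨(v, w), hlt⟩, by simp [hC_def, hv, hw], by simp [hv]⟩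
    · exact ⟨⟨(w, v), hlt⟩, by simp [hC_def, hv, hw], by simp [hYX w hw]⟩
  have h4 : C.card * (k + 1) ≤
      ∑ e ∈ C, (Finset.univ.filter fun c : Fin k => .inr (e, c) ∈ X).card +
      ∑ e ∈ C, (Finset.univ.filter fun c : Fin k => .inr (e, c) ∈ Y).card := by
    rw [← Finset.sum_add_distrib, ← smul_eq_mul]
    refine Finset.card_nsmul_le_sum _ _ _ fun e he => ?_
    rcases hC e he with ⟨h, h'⟩ | ⟨h, h'⟩
    · obtain ⟨a, ha0, hak, haX, haY⟩ := exists_overlap_of_not_touch hn hX hY e.2.ne h (hYX _ h')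
        h' (hXY _ h) fun x hx y hy => (hno x hx y hy).2
      exact le_card_add_card_of_overlap e ha0 hak haX haY
    · obtain ⟨a, ha0, hak, haX, haY⟩ := exists_overlap_of_not_touch hn hY hX e.2.ne h (hXY _ h')
        h' (hYX _ h) fun x hx y hy hadj => (hno y hy x hx).2 hadj.symm
      exact (le_card_add_card_of_overlap e ha0 hak haX haY).trans_eq (Nat.add_comm _ _)
  have h5 : ∀ Z : Set (SubKVert n k), (Finset.univ.filter fun v : Fin n => .inl v ∈ Z).card +
      (Finset.univ.filter fun v : Fin n => .inl v ∉ Z).card = n := fun Z => by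
    rw [Finset.card_filter_add_card_filter_not, Finset.card_univ, Fintype.card_fin]
  have h5X := h5 X
  have h5Y := h5 Y
  have hbX : 0 < (Finset.univ.filter fun v : Fin n => .inl v ∈ X).card :=
    Finset.card_pos.2 ⟨r, by simpa using hr⟩
  have hbY : 0 < (Finset.univ.filter fun v : Fin n => .inl v ∈ Y).card :=
    Finset.card_pos.2 ⟨r', by simpa using hr'⟩
  have hpX : 0 < (Finset.univ.filter fun v : Fin n => .inl v ∉ X).card := by
    obtain ⟨v, hv⟩ := hX.exists_inl_notMem hn hr hXle
    exact Finset.card_pos.2 ⟨v, by simpa using hv⟩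
  have hpY : 0 < (Finset.univ.filter fun v : Fin n => .inl v ∉ Y).card := by
    obtain ⟨v, hv⟩ := hY.exists_inl_notMem hn hr' hYle
    exact Finset.card_pos.2 ⟨v, by simpa using hv⟩
  have h3' := (Nat.mul_le_mul_right (k + 1) h3).trans h4
  have h1' := h1.trans hXle
  have h2' := h2.trans hYle
  clear h1 h2 h3 h4 h5
  generalize (Finset.univ.filter fun v : Fin n => .inl v ∈ X).card = bX at *
  generalize (Finset.univ.filter fun v : Fin n => .inl v ∈ Y).card = bY at *
  generalize (Finset.univ.filter fun v : Fin n => .inl v ∉ X).card = p at *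
  generalize (Finset.univ.filter fun v : Fin n => .inl v ∉ Y).card = q at *
  obtain ⟨x, rfl⟩ : ∃ x, bX = x + 1 := ⟨bX - 1, by omega⟩
  obtain ⟨y, rfl⟩ : ∃ y, bY = y + 1 := ⟨bY - 1, by omega⟩
  obtain ⟨p, rfl⟩ : ∃ x, p = x + 1 := ⟨p - 1, by omega⟩
  obtain ⟨q, rfl⟩ : ∃ x, q = x + 1 := ⟨q - 1, by omega⟩
  have e1 : n - 1 = x + p + 1 := by omega
  have e2 : n - 1 = y + q + 1 := by omega
  have e3 : (k + 1) / 2 ≤ (n - 1) * (k + 1) := by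
    rw [e1]
    nlinarith [Nat.div_le_self (k + 1) 2]
  have e4 : k + 1 ≤ 2 * ((k + 1) / 2) + 1 := by omega
  have e5 : (n - 1) * (k + 1) = (x + p + 1) * (k + 1) := by rw [e1]
  have e6 : (n - 1) * (k + 1) = (y + q + 1) * (k + 1) := by rw [e2]
  simp only [Nat.add_sub_cancel] at h1' h2'
  generalize (n - 1) * (k + 1) = N at *
  generalize (k + 1) / 2 = h at *
  nlinarith [Nat.zero_le (p * q * (k + 1)), Nat.sub_add_cancel e3]

end Counting

/-- A connected tree-decomposition of `subK n k` has a bag with more than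
`(n - 1)(k + 1) - ⌊(k + 1)/2⌋` vertices. -/
theorem TreeDecomp.IsConn.exists_lt_ncard (hn : 3 ≤ n) {ι : Type} {T : SimpleGraph ι}
    {td : TreeDecomp (subK n k) T} (htd : td.IsConn) :
    ∃ t, (n - 1) * (k + 1) - (k + 1) / 2 < (td.bag t).ncard := by
  by_contra! hle
  have hs : k + 2 ≤ (n - 1) * (k + 1) - (k + 1) / 2 := by
    have : 2 * (k + 1) ≤ (n - 1) * (k + 1) := Nat.mul_le_mul_right _ (by omega)
    omega
  have hbag : ∀ t, ∃ X, IsConnSet (subK n k) X ∧ (∃ r, .inl r ∈ X) ∧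
      X.ncard ≤ (n - 1) * (k + 1) - (k + 1) / 2 ∧ td.bag t ⊆ X := by
    intro t
    by_cases hr : ∃ r, .inl r ∈ td.bag t
    · exact ⟨_, htd t, hr, hle t, subset_rfl⟩
    · obtain ⟨i, j, hij, hsub⟩ := (htd t).subset_subKPt (by omega) (not_exists.1 hr)
      exact ⟨_, isConnSet_subKPt hij, ⟨i, 0, by omega, by simp⟩,
        (ncard_subKPt_le i j).trans hs, hsub⟩
  obtain ⟨t₀⟩ := td.isTree.connected.nonempty
  obtain ⟨t, ht⟩ := td.exists_bag_cover (F := {S | ∃ X, IsConnSet (subK n k) X ∧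
      (∃ r, .inl r ∈ X) ∧ X.ncard ≤ (n - 1) * (k + 1) - (k + 1) / 2 ∧ S = subKFar X})
    (by
      obtain ⟨X, h1, h2, h3, -⟩ := hbag t₀
      exact ⟨_, X, h1, h2, h3, rfl⟩)
    (by
      rintro _ ⟨X, hX, ⟨r, hr⟩, hXle, rfl⟩
      obtain ⟨v, hv⟩ := hX.exists_inl_notMem (by omega) hr hXle
      exact hX.isConnSet_subKFar (by omega) hr hv)
    (by
      rintro _ ⟨X, hX, ⟨r, hr⟩, hXle, rfl⟩ _ ⟨Y, hY, ⟨r', hr'⟩, hYle, rfl⟩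
      exact exists_touch_subKFar (by omega) hX hY hr hr' hXle hYle)
  obtain ⟨X, h1, h2, h3, hsub⟩ := hbag t
  obtain ⟨x, hx, hx'⟩ := ht _ ⟨X, h1, h2, h3, rfl⟩
  exact notMem_of_mem_subKFar hx' (hsub hx)

section Star

/-- The tree-decomposition over a star whose leaf bags pairwise meet inside the central bag. -/
def starTreeDecomp {V κ : Type u} {G : SimpleGraph V} (bag : Option κ → Set V)
    (hvert : ∀ v, ∃ t, v ∈ bag t) (hadj : ∀ ⦃u v⦄, G.Adj u v → ∃ t, u ∈ bag t ∧ v ∈ bag t)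
    (hsep : ∀ a b, a ≠ b → bag (some a) ∩ bag (some b) ⊆ bag none) :
    TreeDecomp G (SimpleGraph.starGraph (none : Option κ)) where
  isTree := SimpleGraph.isTree_starGraph _
  bag := bag
  exists_bag := hvert
  exists_bag_adj := hadj
  bag_sep := by
    intro t₁ t₃ p hp t₂ ht₂
    obtain ⟨q, hq⟩ : ∃ q : (SimpleGraph.starGraph (none : Option κ)).Walk t₁ t₃,
        ∀ t ∈ q.support, t = t₁ ∨ t = t₃ ∨ t = none ∧ t₁ ≠ t₃ := by
      rcases eq_or_ne t₁ t₃ with rfl | hne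
      · exact ⟨.nil, by simp⟩
      by_cases h1 : t₁ = none
      · exact ⟨(SimpleGraph.starGraph_adj.2 ⟨hne, .inl h1⟩).toWalk, by simp [h1]⟩
      by_cases h3 : t₃ = none
      · exact ⟨(SimpleGraph.starGraph_adj.2 ⟨hne, .inr h3⟩).toWalk, by simp [h3]⟩
      exact ⟨.cons (SimpleGraph.starGraph_adj.2 ⟨h1, .inr rfl⟩)
        (SimpleGraph.starGraph_adj.2 ⟨Ne.symm h3, .inl rfl⟩).toWalk, by simp; tauto⟩
    rcases hq t₂ ((SimpleGraph.isTree_starGraph _).isAcyclic.support_subset_of_isPath hp q ht₂)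
      with rfl | rfl | ⟨rfl, hne⟩
    · exact Set.inter_subset_left
    · exact Set.inter_subset_right
    · rcases t₁ with _ | a
      · exact Set.inter_subset_left
      rcases t₃ with _ | b
      · exact Set.inter_subset_right
      exact hsep a b (by simpa using hne)

/-- The star of subdivided edges at `c`, where the one towards `l` is cut at distance `a`. -/
def subKStar (k : ℕ) (c l : Fin n) (a : ℕ) : Set (SubKVert n k) :=
  {x | ∃ j d, j ≠ c ∧ d ≤ k + 1 ∧ (j = l → d ≤ a) ∧ x = subKPt k c j d}

variable {c l : Fin n} {a : ℕ}

theorem inl_mem_subKStar (hcl : c ≠ l) {j : Fin n} (hj : j ≠ l) : .inl j ∈ subKStar k c l a := by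
  rcases eq_or_ne j c with rfl | hjc
  · exact ⟨l, 0, hcl.symm, by omega, by omega, by simp⟩
  · exact ⟨j, k + 1, hjc, le_rfl, fun h => absurd h hj, by simp⟩

theorem isConnSet_subKStar (hcl : c ≠ l) : IsConnSet (subK n k) (subKStar k c l a) := by
  refine isConnSet_of_center (inl_mem_subKStar hcl hcl) ?_
  rintro _ ⟨j, d, hj, hd, hda, rfl⟩
  exact connIn_subKPt hj.symm hd fun d' hd' =>
    ⟨j, d', hj, by omega, fun h => hd'.trans (hda h), rfl⟩

theorem ncard_subKStar_le (hcl : c ≠ l) :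
    (subKStar k c l a).ncard ≤ 1 + (n - 2) * (k + 1) + a := by
  classical
  have hsub : subKStar k c l a ⊆ (({.inl c} ∪
      ((Finset.univ \ {c, l}) ×ˢ Finset.Icc 1 (k + 1)).image fun p => subKPt k c p.1 p.2) ∪
      (Finset.Icc 1 a).image (subKPt k c l) : Finset (SubKVert n k)) := by
    rintro _ ⟨j, d, hj, hd, hda, rfl⟩
    rcases Nat.eq_zero_or_pos d with rfl | hd0
    · simp
    rcases eq_or_ne j l with rfl | hjl
    · refine Finset.mem_coe.2 (Finset.mem_union_right _ (Finset.mem_image_of_mem _ ?_))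
      exact Finset.mem_Icc.2 ⟨hd0, hda rfl⟩
    · refine Finset.mem_coe.2 (Finset.mem_union_left _ (Finset.mem_union_right _
        (Finset.mem_image.2 ⟨(j, d), ?_, rfl⟩)))
      simp [hj, hjl, hd]
      omega
  refine (Set.ncard_le_ncard hsub (Finset.finite_toSet _)).trans ?_
  rw [Set.ncard_coe_finset]
  refine (Finset.card_union_le _ _).trans (Nat.add_le_add ((Finset.card_union_le _ _).trans
    (Nat.add_le_add (by simp) (Finset.card_image_le.trans ?_)))
    (Finset.card_image_le.trans (by simp)))
  rw [Finset.card_product, Finset.card_sdiff_of_subset (Finset.subset_univ _),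
    Finset.card_pair hcl]
  simp

open Classical in
/-- The bags of the connected tree-decomposition of `subK n k` over a star. -/
noncomputable def subKBag (k : ℕ) (c l : Fin n) :
    Option {p : Fin n × Fin n // p.1 < p.2} → Set (SubKVert n k)
  | none => subKStar k c l (k + 1 - (k + 1) / 2)
  | some e =>
    if e.1 = (c, l) then subKStar k l c ((k + 1) / 2)
    else if e.1.1 ≠ c ∧ e.1.1 ≠ l ∧ e.1.2 ≠ c ∧ e.1.2 ≠ l then
      {x | ∃ d ≤ k + 1, x = subKPt k e.1.1 e.1.2 d}
    else subKStar k c l (k + 1 - (k + 1) / 2)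

theorem exists_subKBag_of_adj (hcl : c < l) {i j : Fin n} (hij : i ≠ j) {d : ℕ} (hd : d ≤ k) :
    ∃ t, subKPt k i j d ∈ subKBag k c l t ∧ subKPt k i j (d + 1) ∈ subKBag k c l t := by
  wlog h : i = c ∨ (i = l ∧ j ≠ c) ∨ (i < j ∧ i ≠ c ∧ i ≠ l ∧ j ≠ c ∧ j ≠ l) generalizing i j d
  · obtain ⟨t, h1, h2⟩ := this hij.symm (d := k - d) (by omega) (by grind)
    refine ⟨t, ?_, ?_⟩
    · rw [← subKPt_symm hij (by omega)]
      convert h2 using 2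
      omega
    · rw [← subKPt_symm hij (by omega)]
      convert h1 using 2
      omega
  rcases h with rfl | ⟨rfl, hjc⟩ | ⟨hlt, h⟩
  · by_cases hj : j = l ∧ k + 1 - (k + 1) / 2 < d + 1
    · obtain ⟨rfl, hd'⟩ := hj
      refine ⟨some ⟨(i, j), hcl⟩, ?_⟩
      simp only [subKBag, if_true]
      exact ⟨⟨i, k + 1 - d, hij, by omega, by omega, (subKPt_symm hij (by omega)).symm⟩,
        ⟨i, k + 1 - (d + 1), hij, by omega, by omega, (subKPt_symm hij (by omega)).symm⟩⟩
    · exact ⟨none, ⟨j, d, hij.symm, by omega, by omega, rfl⟩,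
        ⟨j, d + 1, hij.symm, by omega, by omega, rfl⟩⟩
  · refine ⟨some ⟨(c, i), hcl⟩, ?_⟩
    simp only [subKBag, if_true]
    exact ⟨⟨j, d, hij.symm, by omega, fun h => absurd h hjc, rfl⟩,
      ⟨j, d + 1, hij.symm, by omega, fun h => absurd h hjc, rfl⟩⟩
  · refine ⟨some ⟨(i, j), hlt⟩, ?_⟩
    have : (i, j) ≠ (c, l) := by simp [h.1]
    simp only [subKBag, if_neg this, if_pos h]
    exact ⟨⟨d, by omega, rfl⟩, ⟨d + 1, by omega, rfl⟩⟩

theorem subKBag_inter_subset (hcl : c < l) {e e' : {p : Fin n × Fin n // p.1 < p.2}}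
    (hne : e ≠ e') : subKBag k c l (some e) ∩ subKBag k c l (some e') ⊆ subKBag k c l none := by
  wlog h : e'.1 ≠ (c, l) generalizing e e'
  · rw [Set.inter_comm]
    exact this hne.symm fun h' => hne (Subtype.ext (h'.trans (not_not.1 h).symm))
  rintro x ⟨hx, hx'⟩
  by_cases he' : e'.1.1 ≠ c ∧ e'.1.1 ≠ l ∧ e'.1.2 ≠ c ∧ e'.1.2 ≠ l
  swap
  · simpa only [subKBag, if_neg h, if_neg he'] using hx'
  simp only [subKBag, if_neg h, if_pos he'] at hx'
  obtain ⟨d, hd, rfl⟩ := hx'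
  rcases Nat.eq_zero_or_pos d with rfl | hd0
  · rw [subKPt_zero]
    exact inl_mem_subKStar hcl.ne he'.2.1
  rcases hd.eq_or_lt with rfl | hlt
  · rw [subKPt_top]
    exact inl_mem_subKStar hcl.ne he'.2.2.2
  have hdk : d ≤ k := by omega
  simp only [subKBag] at hx
  split_ifs at hx with h1 h2
  · obtain ⟨j, d', -, -, -, heq⟩ := hx
    rcases subKPt_inj e'.2.ne hd0 hdk heq with ⟨h3, -⟩ | ⟨h3, -⟩
    · exact absurd h3.symm he'.2.1
    · exact absurd h3.symm he'.2.2.2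
  · obtain ⟨d', -, heq⟩ := hx
    rcases subKPt_inj e'.2.ne hd0 hdk heq with ⟨h3, h4, -⟩ | ⟨h3, h4, -⟩
    · exact absurd (Subtype.ext (Prod.ext h3 h4)) hne
    · have := e.2
      rw [h3, h4] at this
      exact absurd this e'.2.not_gt
  · exact hx

/-- A connected tree-decomposition of `subK n k` of width at most
`(n - 1)(k + 1) - ⌊(k + 1)/2⌋`. -/
theorem exists_treeDecomp_subK (hn : 3 ≤ n) :
    ∃ (ι : Type) (T : SimpleGraph ι) (td : TreeDecomp (subK n k) T),
      td.IsConn ∧ ∀ t, (td.bag t).ncard ≤ (n - 1) * (k + 1) - (k + 1) / 2 + 1 := by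
  obtain ⟨c, l, hcl⟩ : ∃ c l : Fin n, c < l := ⟨⟨0, by omega⟩, ⟨1, by omega⟩, by simp⟩
  have hs : (n - 1) * (k + 1) = (n - 2) * (k + 1) + (k + 1) := by
    rw [← Nat.succ_mul]
    congr 1
    omega
  have hs' : k + 1 ≤ (n - 2) * (k + 1) := Nat.le_mul_of_pos_left _ (by omega)
  have hA : IsConnSet (subK n k) (subKStar k c l (k + 1 - (k + 1) / 2)) ∧
      (subKStar k c l (k + 1 - (k + 1) / 2)).ncard ≤ (n - 1) * (k + 1) - (k + 1) / 2 + 1 := by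
    refine ⟨isConnSet_subKStar hcl.ne, (ncard_subKStar_le hcl.ne).trans ?_⟩
    omega
  refine ⟨_, _, starTreeDecomp (subKBag k c l) (fun v => ?_) (fun u v huv => ?_)
    fun e e' hne => subKBag_inter_subset hcl hne, forall_and.1 fun t => ?_⟩
  · obtain ⟨i, j, d, hij, hd, rfl⟩ := subKPt_cases (by omega) v
    exact (exists_subKBag_of_adj hcl hij hd).imp fun _ => And.left
  · obtain ⟨i, j, d, hij, hd, rfl, rfl⟩ := exists_subKPt_of_adj huv
    exact exists_subKBag_of_adj hcl hij hd
  · change IsConnSet _ (subKBag k c l t) ∧ (subKBag k c l t).ncard ≤ _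
    rcases t with _ | e
    · exact hA
    simp only [subKBag]
    split_ifs with h1 h2
    · refine ⟨isConnSet_subKStar hcl.ne', (ncard_subKStar_le hcl.ne').trans ?_⟩
      omega
    · refine ⟨isConnSet_subKPt e.2.ne, (ncard_subKPt_le _ _).trans ?_⟩
      omega
    · exact hA

end Star

end SubK

/-- the connected tree-width of the `k`-fold subdivision of
`K_n` (`n ≥ 3`) equals `(n − 1)(k + 1) − ⌊(k + 1)/2⌋`. -/
theorem subK_ctw (n k : ℕ) (hn : 3 ≤ n) :
    ctw (subK n k) = (n - 1) * (k + 1) - (k + 1) / 2 := by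
  refine le_antisymm (Nat.sInf_le (exists_treeDecomp_subK hn))
    (le_csInf ⟨_, exists_treeDecomp_subK hn⟩ ?_)
  rintro w ⟨ι, T, td, hconn, hle⟩
  obtain ⟨t, ht⟩ := hconn.exists_lt_ncard hn
  have := hle t
  omega
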